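/- arXiv:1607.02259 — 8 statements merged into one kernel-verified Lean document; each statement's English description precedes it below -/
import Mathlib

section
/- Let n ≥ 2 and let F : Δₙ → ℝ be a continuous convex function on the probability simplex, with regret function D_F. Suppose D_F satisfies sufficiency: for every pair of stochastic maps Φ, Ψ : Δₙ → Δₙ given by row-stochastic matrices and all p, q ∈ Δₙ such that Ψ(Φ(p)) = p and Ψ(Φ(q)) = q, one has D_F(Φ(p), Φ(q)) = D_F(p, q). Then D_F is local: for all p, q, r ∈ Δₙ such that the supports of q and r are each disjoint from the support of p, and all t ∈ [0, 1], D_F((1−t)·p + t·q, p) = D_F((1−t)·p + t·r, p). -/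
/-- The probability simplex in `ℝⁿ`. -/
def simplex (n : ℕ) : Set (Fin n → ℝ) :=
  {p | (∀ i, 0 ≤ p i) ∧ ∑ i, p i = 1}

/-- The regret function of a convex function `F` on the simplex:
`D_F(p,q) = F p - sup { a p : a affine, a ≤ F on the simplex, a q = F q }`. -/
noncomputable def regret {n : ℕ} (F : (Fin n → ℝ) → ℝ) (p q : Fin n → ℝ) : ℝ :=
  F p - sSup {y : ℝ | ∃ a : (Fin n → ℝ) →ᵃ[ℝ] ℝ,
    (∀ x ∈ simplex n, a x ≤ F x) ∧ a q = F q ∧ y = a p}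

/-- A matrix is row-stochastic if its entries are nonnegative and each row sums
to `1`. -/
def RowStochastic {n m : ℕ} (M : Matrix (Fin n) (Fin m) ℝ) : Prop :=
  (∀ i j, 0 ≤ M i j) ∧ ∀ i, ∑ j, M i j = 1

/-- The stochastic map (channel) on probability vectors determined by a
row-stochastic matrix. -/
def channel {n m : ℕ} (M : Matrix (Fin n) (Fin m) ℝ) (p : Fin n → ℝ) : Fin m → ℝ :=
  fun j => ∑ i, p i * M i j

/-- The matrix that fixes the support of `p` and sends everything else to `r`. -/
noncomputable def replaceOff {n : ℕ} (p r : Fin n → ℝ) : Matrix (Fin n) (Fin n) ℝ :=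
  fun i j => if p i = 0 then r j else (if i = j then 1 else 0)

lemma replaceOff_stochastic {n : ℕ} (p r : Fin n → ℝ) (hr : r ∈ simplex n) :
    RowStochastic (replaceOff p r) := by
  constructor
  · intro i j
    have := hr.1 j
    unfold replaceOff
    split_ifs <;> first | assumption | norm_num
  · intro i
    unfold replaceOff
    by_cases h : p i = 0
    · simp [h, hr.2]
    · simp [h]

lemma channel_replaceOff {n : ℕ} (p q r : Fin n → ℝ) (hq : q ∈ simplex n)
    (hd : Disjoint (Function.support q) (Function.support p)) (t : ℝ) :
    channel (replaceOff p r) (fun i => (1 - t) * p i + t * q i)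
      = fun i => (1 - t) * p i + t * r i := by
  funext j
  have key : ∀ i, ((1 - t) * p i + t * q i) * replaceOff p r i j
      = (1 - t) * (if i = j then p i else 0) + t * r j * q i := by
    intro i
    unfold replaceOff
    by_cases h : p i = 0
    · simp [h]; ring
    · have hqi : q i = 0 := by
        by_contra h2
        exact Set.disjoint_left.mp hd h2 h
      by_cases hij : i = j
      · subst hij; simp [h, hqi]
      · simp [h, hqi, hij]
  simp only [channel, key, Finset.sum_add_distrib, ← Finset.mul_sum, hq.2]
  simp

lemma mix_mem {n : ℕ} (p q : Fin n → ℝ) (hp : p ∈ simplex n) (hq : q ∈ simplex n)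
    (t : ℝ) (h0 : 0 ≤ t) (h1 : t ≤ 1) :
    (fun i => (1 - t) * p i + t * q i) ∈ simplex n := by
  constructor
  · intro i
    have := mul_nonneg (sub_nonneg.mpr h1) (hp.1 i)
    have := mul_nonneg h0 (hq.1 i)
    show 0 ≤ (1 - t) * p i + t * q i
    linarith
  · simp only [Finset.sum_add_distrib, ← Finset.mul_sum, hp.2, hq.2]
    ring

/-- If the regret function of a continuous convex function on the simplex (`n ≥ 2`)
satisfies sufficiency, then it is local. -/
theorem regret_sufficiency_implies_local {n : ℕ} (hn : 2 ≤ n)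
    (F : (Fin n → ℝ) → ℝ)
    (hFcont : ContinuousOn F (simplex n))
    (hFconv : ConvexOn ℝ (simplex n) F)
    (hsuff : ∀ p ∈ simplex n, ∀ q ∈ simplex n,
      ∀ M N : Matrix (Fin n) (Fin n) ℝ, RowStochastic M → RowStochastic N →
        channel N (channel M p) = p → channel N (channel M q) = q →
          regret F (channel M p) (channel M q) = regret F p q) :
    ∀ p ∈ simplex n, ∀ q ∈ simplex n, ∀ r ∈ simplex n,
      Disjoint (Function.support q) (Function.support p) →
      Disjoint (Function.support r) (Function.support p) →
      ∀ t : ℝ, 0 ≤ t → t ≤ 1 →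
        regret F (fun i => (1 - t) * p i + t * q i) p
          = regret F (fun i => (1 - t) * p i + t * r i) p := by
  intro p hp q hq r hr hqd hrd t h0 h1
  have e1 := channel_replaceOff p q r hq hqd t
  have e2 := channel_replaceOff p r q hr hrd t
  have f1 : channel (replaceOff p r) p = p := by
    simpa using channel_replaceOff p q r hq hqd 0
  have f2 : channel (replaceOff p q) p = p := by
    simpa using channel_replaceOff p r q hr hrd 0
  have h := hsuff _ (mix_mem p q hp hq t h0 h1) p hp (replaceOff p r) (replaceOff p q)
    (replaceOff_stochastic p r hr) (replaceOff_stochastic p q hq)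
    (by rw [e1, e2]) (by rw [f1, f2])
  rw [e1, f1] at h
  exact h.symm
end

section
/- Every convex function f : ℝⁿ → ℝ is differentiable almost everywhere with respect to the Lebesgue measure on ℝⁿ. -/
open MeasureTheory

/-- Alexandrov / Rademacher-type theorem: a convex function on `ℝⁿ` is
(Fréchet) differentiable almost everywhere with respect to Lebesgue measure. -/
theorem convex_differentiable_ae {n : ℕ} (f : (Fin n → ℝ) → ℝ)
    (hf : ConvexOn ℝ Set.univ f) :
    ∀ᵐ x ∂(volume : Measure (Fin n → ℝ)), DifferentiableAt ℝ f x := by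
  have hl : LocallyLipschitz f := hf.locallyLipschitz
  rw [ae_iff]
  refine measure_null_of_locally_null _ fun x _ => ?_
  obtain ⟨K, t, ht, hK⟩ := hl x
  obtain ⟨u, hut, huo, hxu⟩ := mem_nhds_iff.1 ht
  refine ⟨{y | ¬ DifferentiableAt ℝ f y} ∩ u,
    Filter.inter_mem self_mem_nhdsWithin (mem_nhdsWithin_of_mem_nhds (huo.mem_nhds hxu)), ?_⟩
  have h := (hK.mono hut).ae_differentiableWithinAt_of_mem (μ := volume)
  refine measure_mono_null ?_ (ae_iff.1 h)
  rintro y ⟨hy, hyu⟩ hd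
  exact hy ((hd hyu).differentiableAt (huo.mem_nhds hyu))
end

section
/- Let A and B be n × n complex Hermitian matrices, and suppose A = ∑_{ℓ=1}^{k} t_ℓ • E_ℓ where t_1, …, t_k are real numbers and E_1, …, E_k are Hermitian idempotent matrices (E_ℓ² = E_ℓ = E_ℓᴴ) with E_m * E_n = 0 for m ≠ n and ∑_ℓ E_ℓ = 1. Let f be a polynomial with real coefficients. Then the map t ↦ f(A + t•B) (polynomial evaluation of a matrix, t real) has derivative at t = 0 equal to ∑_{m,n} a_{mn} • (E_m * B * E_n), where a_{mn} = (f(t_m) − f(t_n))/(t_m − t_n) when t_m ≠ t_n and a_{mn} = f′(t_m) when t_m = t_n, with f′ the formal derivative of f. -/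
open Matrix Polynomial

attribute [local instance] Matrix.normedAddCommGroup Matrix.normedSpace


/-- Product rule for matrix-valued functions, with the entrywise norm. -/
theorem matrix_hasDerivAt_mul {n : ℕ} {F G : ℝ → Matrix (Fin n) (Fin n) ℂ}
    {F' G' : Matrix (Fin n) (Fin n) ℂ} {x : ℝ}
    (hF : HasDerivAt F F' x) (hG : HasDerivAt G G' x) :
    HasDerivAt (fun s => F s * G s) (F' * G x + F x * G') x := by
  have hF2 : ∀ i j, HasDerivAt (fun s => F s i j) (F' i j) x := fun i j =>
    hasDerivAt_pi.1 (hasDerivAt_pi.1 hF i) j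
  have hG2 : ∀ i j, HasDerivAt (fun s => G s i j) (G' i j) x := fun i j =>
    hasDerivAt_pi.1 (hasDerivAt_pi.1 hG i) j
  refine hasDerivAt_pi.2 fun i => hasDerivAt_pi.2 fun j => ?_
  have h := HasDerivAt.fun_sum (u := Finset.univ)
    (fun l _ => (hF2 i l).mul (hG2 l j))
  have e : (F' * G x + F x * G') i j = ∑ l, (F' i l * G x l j + F x i l * G' l j) := by
    simp [Matrix.mul_apply, Finset.sum_add_distrib]
  rw [e]
  simpa [Matrix.mul_apply] using h

/-- Divided difference of a polynomial. -/
noncomputable def polyDD (f : Polynomial ℝ) (x y : ℝ) : ℝ :=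
  if x = y then f.derivative.eval x else (f.eval x - f.eval y) / (x - y)

theorem polyDD_C (c x y : ℝ) : polyDD (C c) x y = 0 := by
  simp [polyDD]

theorem polyDD_add (p q : Polynomial ℝ) (x y : ℝ) :
    polyDD (p + q) x y = polyDD p x y + polyDD q x y := by
  unfold polyDD
  split_ifs
  · simp
  · simp only [eval_add]; ring

theorem polyDD_mul_X (p : Polynomial ℝ) (x y : ℝ) :
    polyDD (p * X) x y = polyDD p x y * y + p.eval x := by
  unfold polyDD
  split_ifs with h
  · subst h; simp
  · have : x - y ≠ 0 := sub_ne_zero.2 h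
    simp only [eval_mul, eval_X]; field_simp; ring

theorem poly_induct {P : Polynomial ℝ → Prop} (hC : ∀ c, P (C c))
    (hadd : ∀ p q, P p → P q → P (p + q)) (hX : ∀ p, P p → P (p * X)) (f : Polynomial ℝ) :
    P f := by
  refine Polynomial.induction_on f hC hadd ?_
  intro m c h
  rw [pow_succ, ← mul_assoc]
  exact hX _ h

/-- Derivative of `t ↦ f(A + t B)` at `t = 0` for Hermitian `A, B` with `A`
written in terms of a complete family of pairwise-orthogonal Hermitian
idempotents. -/
theorem deriv_poly_matrix {n k : ℕ}
    (A B : Matrix (Fin n) (Fin n) ℂ) (hA : A.IsHermitian) (hB : B.IsHermitian)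
    (t : Fin k → ℝ) (E : Fin k → Matrix (Fin n) (Fin n) ℂ)
    (hidem : ∀ ℓ, E ℓ * E ℓ = E ℓ)
    (hherm : ∀ ℓ, (E ℓ).conjTranspose = E ℓ)
    (horth : ∀ m l, m ≠ l → E m * E l = 0)
    (hsum : ∑ ℓ, E ℓ = 1)
    (hdecomp : A = ∑ ℓ, (t ℓ : ℂ) • E ℓ)
    (f : Polynomial ℝ)
    (a : Fin k → Fin k → ℝ)
    (ha : ∀ m l, a m l = if t m = t l then f.derivative.eval (t m)
      else (f.eval (t m) - f.eval (t l)) / (t m - t l)) :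
    HasDerivAt (fun s : ℝ => aeval (A + s • B) f)
      (∑ m, ∑ l, a m l • (E m * B * E l)) 0 := by
  have hEA : ∀ l, E l * A = t l • E l := by
    intro l
    rw [hdecomp, Finset.mul_sum, Finset.sum_eq_single l]
    · rw [mul_smul_comm, hidem]; rfl
    · intro b _ hb
      rw [mul_smul_comm, horth _ _ hb.symm, smul_zero]
    · simp
  have hpA : ∀ p : Polynomial ℝ, aeval A p = ∑ m, p.eval (t m) • E m := by
    refine poly_induct ?_ ?_ ?_
    · intro c
      simp only [aeval_C, eval_C]
      rw [← Finset.smul_sum, hsum, Algebra.algebraMap_eq_smul_one]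
    · intro p q hp hq
      simp only [map_add, hp, hq, eval_add, add_smul, Finset.sum_add_distrib]
    · intro p hp
      simp only [map_mul, aeval_X, hp, eval_mul, eval_X, Finset.sum_mul, smul_mul_assoc, hEA,
        smul_smul]
  have key : ∀ p : Polynomial ℝ, HasDerivAt (fun s : ℝ => aeval (A + s • B) p)
      (∑ m, ∑ l, polyDD p (t m) (t l) • (E m * B * E l)) 0 := by
    refine poly_induct ?_ ?_ ?_
    · intro c
      simp only [aeval_C, polyDD_C, zero_smul, Finset.sum_const_zero]
      exact hasDerivAt_const _ _
    · intro p q hp hq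
      simp only [map_add, polyDD_add, add_smul, Finset.sum_add_distrib]
      exact hp.add hq
    · intro p hp
      have h1 : HasDerivAt (fun s : ℝ => A + s • B) B 0 := by
        have h0 := ((hasDerivAt_id (0 : ℝ)).smul_const B).const_add A
        rw [one_smul] at h0
        exact h0
      have h2 := matrix_hasDerivAt_mul hp h1
      simp only [map_mul, aeval_X]
      convert h2 using 1
      simp only [zero_smul, add_zero, hpA, Finset.sum_mul, smul_mul_assoc, mul_assoc, hEA,
        polyDD_mul_X, add_smul, Finset.sum_add_distrib, mul_smul_comm, smul_smul]
      congr 1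
      refine Finset.sum_congr rfl fun m _ => ?_
      rw [← Finset.smul_sum, ← Finset.mul_sum, ← Finset.mul_sum, hsum, mul_one]
  have haa : ∀ m l, a m l = polyDD f (t m) (t l) := ha
  simp only [haa]
  exact key f
end

section
/- Let A and B be n × n complex Hermitian matrices and let f be a polynomial with real coefficients, with formal derivative f′. Then the real-variable function t ↦ Tr(f(A + t•B)) has derivative at t = 0 equal to Tr(f′(A) * B). -/
open Matrix Polynomial

section aux
attribute [local instance] Matrix.linftyOpNormedRing Matrix.linftyOpNormedAlgebra

lemma aux_deriv {n : ℕ} (A B : Matrix (Fin n) (Fin n) ℂ) (f : Polynomial ℝ) :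
    ∃ D : Matrix (Fin n) (Fin n) ℂ, HasDerivAt (fun s : ℝ => aeval (A + s • B) f) D 0 ∧
      ∀ C, A * C = C * A → (D * C).trace = (aeval A f.derivative * B * C).trace := by
  induction f using Polynomial.induction_on with
  | C a =>
    refine ⟨0, ?_, ?_⟩
    · simp only [aeval_C]
      exact hasDerivAt_const _ _
    · simp
  | add p q hp hq =>
    obtain ⟨D, hD, h1⟩ := hp
    obtain ⟨E, hE, h2⟩ := hq
    refine ⟨D + E, ?_, ?_⟩
    · simp only [map_add]
      exact hD.add hE
    · intro M hM
      simp only [map_add, add_mul, trace_add, h1 M hM, h2 M hM]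
  | monomial k a ih =>
    obtain ⟨D, hD, h1⟩ := ih
    have hlin : HasDerivAt (fun s : ℝ => A + s • B) B 0 := by
      have h0 := ((hasDerivAt_id (0 : ℝ)).smul_const B).const_add A
      rw [one_smul] at h0
      exact h0
    have hmul := hD.mul hlin
    rw [zero_smul, add_zero] at hmul
    refine ⟨D * A + aeval A (C a * X ^ k) * B, ?_, ?_⟩
    · have e : (fun s : ℝ => aeval (A + s • B) (C a * X ^ (k + 1))) =
          (fun s : ℝ => aeval (A + s • B) (C a * X ^ k)) * (fun s : ℝ => A + s • B) := by
        funext s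
        simp [pow_succ, mul_assoc]
      rw [e]
      exact hmul
    · intro M hM
      have e : (C a * X ^ (k + 1) : Polynomial ℝ) = X * (C a * X ^ k) := by ring
      rw [e, derivative_mul, derivative_X, one_mul, map_add, map_mul (aeval A) X, aeval_X]
      have h2 := h1 (A * M) (by rw [mul_assoc, hM])
      simp only [add_mul, trace_add]
      rw [mul_assoc D A M, h2, hM, ← mul_assoc, trace_mul_comm _ A]
      simp only [mul_assoc]
      rw [add_comm]

lemma aux_trace {n : ℕ} (A B : Matrix (Fin n) (Fin n) ℂ) (f : Polynomial ℝ) :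
    HasDerivAt (fun s : ℝ => (aeval (A + s • B) f).trace)
      ((aeval A f.derivative * B).trace) 0 := by
  obtain ⟨D, hD, h⟩ := aux_deriv A B f
  have h1 := h 1 (by simp)
  rw [mul_one, mul_one] at h1
  rw [← h1]
  exact ((Matrix.traceLinearMap (Fin n) ℝ ℂ).toContinuousLinearMap).hasFDerivAt.comp_hasDerivAt
    (0 : ℝ) hD

end aux

/-- For Hermitian matrices `A, B` and a real polynomial `f`, the function
`t ↦ Tr (f (A + t B))` has derivative `Tr (f' (A) * B)` at `t = 0`. -/
theorem deriv_trace_poly_matrix {n : ℕ}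
    (A B : Matrix (Fin n) (Fin n) ℂ) (hA : A.IsHermitian) (hB : B.IsHermitian)
    (f : Polynomial ℝ) :
    HasDerivAt (fun s : ℝ => (aeval (A + s • B) f).trace)
      ((aeval A f.derivative * B).trace) 0 := by
  exact aux_trace A B f
end

section
/- Let A and B be n × n complex Hermitian matrices, and suppose A = ∑_{ℓ=1}^{k} t_ℓ • E_ℓ where t_1, …, t_k are real numbers and E_1, …, E_k are Hermitian idempotent matrices (E_ℓ² = E_ℓ = E_ℓᴴ) with E_m * E_n = 0 for m ≠ n and ∑_ℓ E_ℓ = 1. Let f be a polynomial with real coefficients with formal derivatives f′ and f″. Then the second derivative at t = 0 of the real-variable function t ↦ Tr(f(A + t•B)) equals ∑_{m,n} ã_{mn} · Tr(E_m * B * E_n * B), where ã_{mn} = (f′(t_m) − f′(t_n))/(t_m − t_n) when t_m ≠ t_n and ã_{mn} = f″(t_m) when t_m = t_n. -/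
open Matrix Polynomial

section Helpers

theorem aux_pow {R : Type*} [NormedRing R] [NormedAlgebra ℝ R] (A B : R) (s : ℝ) (k : ℕ) :
    HasDerivAt (fun s : ℝ => (A + s • B) ^ k)
      (∑ i ∈ Finset.range k, (A + s • B) ^ i * B * (A + s • B) ^ (k - 1 - i)) s := by
  have h1 : HasDerivAt (fun s : ℝ => A + s • B) B s := by
    have h := ((hasDerivAt_id s).smul_const B).const_add A
    rw [one_smul] at h
    exact h
  induction k with
  | zero => simpa using hasDerivAt_const s (1 : R)
  | succ k ih =>
    have h := ih.mul h1
    have e : (∑ i ∈ Finset.range (k + 1), (A + s • B) ^ i * B * (A + s • B) ^ (k + 1 - 1 - i))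
        = (∑ i ∈ Finset.range k, (A + s • B) ^ i * B * (A + s • B) ^ (k - 1 - i)) * (A + s • B)
          + (A + s • B) ^ k * B := by
      rw [Finset.sum_range_succ, Finset.sum_mul]
      congr 1
      · refine Finset.sum_congr rfl fun i hi => ?_
        have hi := Finset.mem_range.1 hi
        rw [mul_assoc _ _ (A + s • B), ← pow_succ]
        congr 2
        omega
      · simp
    rw [e]
    simp only [pow_succ]
    exact h

theorem aux_lin_pow {R : Type*} [NormedRing R] [NormedAlgebra ℝ R] [FiniteDimensional ℝ R]
    (L : R →ₗ[ℝ] ℂ) (A B : R) (s : ℝ) (k : ℕ) :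
    HasDerivAt (fun s : ℝ => L ((A + s • B) ^ k))
      (∑ i ∈ Finset.range k, L ((A + s • B) ^ i * B * (A + s • B) ^ (k - 1 - i))) s := by
  have h2 := (LinearMap.toContinuousLinearMap L).hasFDerivAt.comp_hasDerivAt s (aux_pow A B s k)
  rw [← map_sum]
  exact h2

theorem aux_trace_pow {n : ℕ} (A B C : Matrix (Fin n) (Fin n) ℂ) (s : ℝ) (k : ℕ) :
    HasDerivAt (fun s : ℝ => ((A + s • B) ^ k * C).trace)
      (∑ i ∈ Finset.range k,
        ((A + s • B) ^ i * B * (A + s • B) ^ (k - 1 - i) * C).trace) s := by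
  let L : Matrix (Fin n) (Fin n) ℂ →ₗ[ℝ] ℂ :=
    (Matrix.traceLinearMap (Fin n) ℝ ℂ).comp (LinearMap.mulRight ℝ C)
  have hf : FiniteDimensional ℝ (Matrix (Fin n) (Fin n) ℂ) := inferInstance
  letI i1 : NormedRing (Matrix (Fin n) (Fin n) ℂ) := Matrix.linftyOpNormedRing
  letI i2 : NormedAlgebra ℝ (Matrix (Fin n) (Fin n) ℂ) := Matrix.linftyOpNormedAlgebra
  exact @aux_lin_pow _ i1 i2 hf L A B s k

end Helpers

theorem aux_first {n : ℕ} (A B : Matrix (Fin n) (Fin n) ℂ) (s : ℝ) (f : Polynomial ℝ) :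
    HasDerivAt (fun s : ℝ => (aeval (A + s • B) f).trace)
      ((aeval (A + s • B) f.derivative * B).trace) s := by
  induction f using Polynomial.induction_on' with
  | add p q hp hq =>
    simp only [map_add, add_mul, Matrix.trace_add]
    exact hp.add hq
  | monomial k c =>
    have h := (aux_trace_pow A B 1 s k).const_smul c
    simp only [mul_one] at h
    have e : ∀ i ∈ Finset.range k,
        ((A + s • B) ^ i * B * (A + s • B) ^ (k - 1 - i)).trace
          = ((A + s • B) ^ (k - 1) * B).trace := by
      intro i hi
      have hi := Finset.mem_range.1 hi
      rw [Matrix.trace_mul_comm, ← mul_assoc, ← pow_add]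
      congr 3
      omega
    rw [Finset.sum_congr rfl e, Finset.sum_const, Finset.card_range] at h
    refine HasDerivAt.congr_deriv (f' := _) (h.congr_of_eventuallyEq (Filter.Eventually.of_forall fun s => ?_)) ?_
    ·       simp [aeval_monomial, ← Algebra.smul_def, Matrix.trace_smul]
    · symm
      rw [derivative_monomial, aeval_monomial, ← Algebra.smul_def, smul_mul_assoc,
        Matrix.trace_smul, mul_smul, Nat.cast_smul_eq_nsmul]

/-- divided difference -/
noncomputable def auxDD (g : Polynomial ℝ) (x y : ℝ) : ℝ :=
  if x = y then g.derivative.eval x else (g.eval x - g.eval y) / (x - y)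

theorem auxDD_add (p q : Polynomial ℝ) (x y : ℝ) :
    auxDD (p + q) x y = auxDD p x y + auxDD q x y := by
  unfold auxDD
  split_ifs
  · simp
  · simp only [eval_add]; ring

theorem auxDD_monomial (k : ℕ) (c x y : ℝ) :
    auxDD (monomial k c) x y = c * ∑ i ∈ Finset.range k, x ^ i * y ^ (k - 1 - i) := by
  unfold auxDD
  split_ifs with h
  · subst h
    have e : ∀ i ∈ Finset.range k, x ^ i * x ^ (k - 1 - i) = x ^ (k - 1) := by
      intro i hi
      have hi := Finset.mem_range.1 hi
      rw [← pow_add]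
      congr 1
      omega
    rw [Finset.sum_congr rfl e]
    simp [derivative_monomial]
    ring
  · have h' : x - y ≠ 0 := sub_ne_zero.2 h
    rw [div_eq_iff h', mul_assoc, (Commute.all x y).geom_sum₂_mul]
    simp
    ring

theorem aux_spec_pow {n k : ℕ} (t : Fin k → ℝ) (E : Fin k → Matrix (Fin n) (Fin n) ℂ)
    (hidem : ∀ ℓ, E ℓ * E ℓ = E ℓ)
    (horth : ∀ m l, m ≠ l → E m * E l = 0)
    (hsum : ∑ ℓ, E ℓ = 1) (i : ℕ) :
    (∑ ℓ, t ℓ • E ℓ) ^ i = ∑ ℓ, (t ℓ ^ i) • E ℓ := by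
  induction i with
  | zero => simp [hsum]
  | succ i ih =>
    rw [pow_succ, ih, Finset.sum_mul]
    refine Finset.sum_congr rfl fun m _ => ?_
    rw [Finset.mul_sum, Finset.sum_eq_single m]
    · rw [smul_mul_smul_comm, hidem, pow_succ]
    · intro l _ hl
      rw [smul_mul_smul_comm, horth m l hl.symm, smul_zero]
    · simp

theorem aux_second {n k : ℕ} (B : Matrix (Fin n) (Fin n) ℂ)
    (t : Fin k → ℝ) (E : Fin k → Matrix (Fin n) (Fin n) ℂ)
    (hidem : ∀ ℓ, E ℓ * E ℓ = E ℓ)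
    (horth : ∀ m l, m ≠ l → E m * E l = 0)
    (hsum : ∑ ℓ, E ℓ = 1) (g : Polynomial ℝ) :
    HasDerivAt (fun s : ℝ => (aeval ((∑ ℓ, t ℓ • E ℓ) + s • B) g * B).trace)
      (∑ m, ∑ l, auxDD g (t m) (t l) • (E m * B * E l * B).trace) 0 := by
  induction g using Polynomial.induction_on' with
  | add p q hp hq =>
    simp only [map_add, add_mul, Matrix.trace_add, auxDD_add, add_smul, Finset.sum_add_distrib]
    exact hp.add hq
  | monomial d c =>
    have h := (aux_trace_pow (∑ ℓ, t ℓ • E ℓ) B B 0 d).const_smul c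
    refine HasDerivAt.congr_deriv (f' := _) (h.congr_of_eventuallyEq (Filter.Eventually.of_forall fun s => ?_)) ?_
    ·       simp [aeval_monomial, ← Algebra.smul_def, Matrix.trace_smul]
    · symm
      simp only [zero_smul, add_zero, aux_spec_pow t E hidem horth hsum]
      have e : ∀ i, ((∑ ℓ, (t ℓ ^ i) • E ℓ) * B * (∑ ℓ, (t ℓ ^ (d - 1 - i)) • E ℓ) * B).trace
          = ∑ m, ∑ l, (t m ^ i * t l ^ (d - 1 - i)) • (E m * B * E l * B).trace := by
        intro i
        rw [Finset.sum_mul, Finset.sum_mul, Finset.sum_mul, Matrix.trace_sum]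
        refine Finset.sum_congr rfl fun m _ => ?_
        rw [Finset.mul_sum, Finset.sum_mul, Matrix.trace_sum]
        refine Finset.sum_congr rfl fun l _ => ?_
        rw [smul_mul_assoc, smul_mul_smul_comm, smul_mul_assoc, Matrix.trace_smul]
      simp only [e, auxDD_monomial, Finset.sum_comm (s := Finset.range d)]
      rw [Finset.smul_sum]
      refine Finset.sum_congr rfl fun m _ => ?_
      rw [Finset.smul_sum]
      refine Finset.sum_congr rfl fun l _ => ?_
      rw [mul_smul, Finset.sum_smul]



/-- Second derivative of `t ↦ Tr (f (A + t B))` at `t = 0` for Hermitian `A, B`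
with `A` written in terms of a complete family of pairwise-orthogonal Hermitian
idempotents. -/
theorem second_deriv_trace_poly_matrix {n k : ℕ}
    (A B : Matrix (Fin n) (Fin n) ℂ) (hA : A.IsHermitian) (hB : B.IsHermitian)
    (t : Fin k → ℝ) (E : Fin k → Matrix (Fin n) (Fin n) ℂ)
    (hidem : ∀ ℓ, E ℓ * E ℓ = E ℓ)
    (hherm : ∀ ℓ, (E ℓ).conjTranspose = E ℓ)
    (horth : ∀ m l, m ≠ l → E m * E l = 0)
    (hsum : ∑ ℓ, E ℓ = 1)
    (hdecomp : A = ∑ ℓ, (t ℓ : ℂ) • E ℓ)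
    (f : Polynomial ℝ)
    (a : Fin k → Fin k → ℝ)
    (ha : ∀ m l, a m l = if t m = t l then f.derivative.derivative.eval (t m)
      else (f.derivative.eval (t m) - f.derivative.eval (t l)) / (t m - t l)) :
    iteratedDeriv 2 (fun s : ℝ => (aeval (A + s • B) f).trace) 0
      = ∑ m, ∑ l, a m l • (E m * B * E l * B).trace := by
  have hA' : A = ∑ ℓ, t ℓ • E ℓ := by
    rw [hdecomp]
    refine Finset.sum_congr rfl fun m _ => ?_
    ext i j
    simp
  have h1 : deriv (fun s : ℝ => (aeval (A + s • B) f).trace)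
      = fun s : ℝ => (aeval (A + s • B) f.derivative * B).trace :=
    funext fun s => (aux_first A B s f).deriv
  rw [iteratedDeriv_succ, iteratedDeriv_one, h1, hA',
    (aux_second B t E hidem horth hsum f.derivative).deriv]
  simp only [ha, auxDD]
end

section
/- The von Neumann entropy is strictly concave on positive definite complex matrices: if A and B are n × n positive definite Hermitian complex matrices with A ≠ B, and t ∈ (0, 1), then H(t•A + (1−t)•B) > t·H(A) + (1−t)·H(B), where H(M) = −Tr(M * log M) and log M is defined by applying the real logarithm to M via the continuous functional calculus (equivalently, applying ln to the eigenvalues in a spectral decomposition of M). -/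
open Matrix
open scoped ComplexOrder

variable {n : ℕ}

/-- The matrix logarithm of a Hermitian matrix, obtained by applying the real
logarithm through the functional calculus (junk value `0` if the matrix is not
Hermitian). -/
noncomputable def matLog (M : Matrix (Fin n) (Fin n) ℂ) : Matrix (Fin n) (Fin n) ℂ :=
  if h : M.IsHermitian then h.cfc Real.log else 0

/-- The von Neumann entropy `H(M) = -Tr (M * log M)` (which is a real number for
Hermitian `M`). -/
noncomputable def vnEntropy (M : Matrix (Fin n) (Fin n) ℂ) : ℝ :=
  (-(M * matLog M).trace).re

/-- trace formula -/
lemma trace_conj_formula (U V : Matrix (Fin n) (Fin n) ℂ) (d e : Fin n → ℝ) :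
    ((U * diagonal (fun i => (d i : ℂ)) * Uᴴ) *
      (V * diagonal (fun i => (e i : ℂ)) * Vᴴ)).trace
      = ((∑ i, ∑ j, Complex.normSq ((Uᴴ * V) i j) * (d i * e j) : ℝ) : ℂ) := by
  have h1 : ((U * diagonal (fun i => (d i : ℂ)) * Uᴴ) *
      (V * diagonal (fun i => (e i : ℂ)) * Vᴴ)).trace =
      ((diagonal (fun i => (d i : ℂ)) * (Uᴴ * V)) *
        (diagonal (fun i => (e i : ℂ)) * (Uᴴ * V)ᴴ)).trace := by
    rw [conjTranspose_mul, conjTranspose_conjTranspose]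
    simp only [Matrix.mul_assoc]
    rw [trace_mul_comm U]
    simp only [Matrix.mul_assoc]
  rw [h1]
  generalize Uᴴ * V = W
  push_cast
  simp only [trace, diag_apply]
  refine Finset.sum_congr rfl fun i _ => ?_
  rw [mul_apply]
  refine Finset.sum_congr rfl fun j _ => ?_
  rw [diagonal_mul, diagonal_mul, conjTranspose_apply, Complex.normSq_eq_conj_mul_self]
  simp only [Complex.star_def]
  ring

lemma sum_normSq_row {W : Matrix (Fin n) (Fin n) ℂ} (h : W * Wᴴ = 1) (i : Fin n) :
    ∑ j, Complex.normSq (W i j) = 1 := by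
  have := congrFun (congrFun h i) i
  rw [mul_apply, one_apply_eq] at this
  have h2 : ((∑ j, Complex.normSq (W i j) : ℝ) : ℂ) = 1 := by
    rw [← this]
    push_cast
    refine Finset.sum_congr rfl fun j _ => ?_
    rw [conjTranspose_apply, Complex.normSq_eq_conj_mul_self, Complex.star_def, mul_comm]
  exact_mod_cast h2

lemma sum_normSq_col {W : Matrix (Fin n) (Fin n) ℂ} (h : Wᴴ * W = 1) (j : Fin n) :
    ∑ i, Complex.normSq (W i j) = 1 := by
  have := sum_normSq_row (W := Wᴴ) (by simpa using h) j
  simpa [conjTranspose_apply] using this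

lemma klein_scalar_lt {a c : ℝ} (ha : 0 < a) (hc : 0 < c) (hne : a ≠ c) :
    0 < a * Real.log a - a * Real.log c - a + c := by
  have h := Real.log_lt_sub_one_of_pos (div_pos hc ha)
    (by rw [Ne, div_eq_one_iff_eq ha.ne']; exact hne.symm)
  rw [Real.log_div hc.ne' ha.ne'] at h
  have h2 := mul_lt_mul_of_pos_left h ha
  have h3 : a * (c / a - 1) = c - a := by field_simp
  rw [h3] at h2
  linarith

lemma klein_scalar {a c : ℝ} (ha : 0 < a) (hc : 0 < c) :
    0 ≤ a * Real.log a - a * Real.log c - a + c := by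
  by_cases h : a = c
  · subst h; simp
  · exact (klein_scalar_lt ha hc h).le

/-- spectral decomposition in explicit form -/
lemma exists_spectral {A : Matrix (Fin n) (Fin n) ℂ} (hA : A.PosDef) :
    ∃ (U : Matrix (Fin n) (Fin n) ℂ) (a : Fin n → ℝ), Uᴴ * U = 1 ∧ U * Uᴴ = 1 ∧ (∀ i, 0 < a i) ∧
      A = U * diagonal (fun i => (a i : ℂ)) * Uᴴ ∧
      matLog A = U * diagonal (fun i => (Real.log (a i) : ℂ)) * Uᴴ := by
  refine ⟨hA.isHermitian.eigenvectorUnitary, hA.isHermitian.eigenvalues, ?_, ?_,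
    hA.eigenvalues_pos, ?_, ?_⟩
  · exact Unitary.coe_star_mul_self _
  · exact Unitary.coe_mul_star_self _
  · exact hA.isHermitian.spectral_theorem
  · rw [matLog, dif_pos hA.isHermitian]
    rfl

lemma klein_strict {A C : Matrix (Fin n) (Fin n) ℂ} (hA : A.PosDef) (hC : C.PosDef)
    (hne : A ≠ C) :
    (A.trace).re - (C.trace).re < (A * matLog A).trace.re - (A * matLog C).trace.re := by
  obtain ⟨U, a, hU1, hU2, ha, hAe, hAl⟩ := exists_spectral hA
  obtain ⟨V, c, hV1, hV2, hc, hCe, hCl⟩ := exists_spectral hC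
  have hW1 : (Uᴴ * V)ᴴ * (Uᴴ * V) = 1 := by
    rw [conjTranspose_mul, conjTranspose_conjTranspose, Matrix.mul_assoc, ← Matrix.mul_assoc U, hU2,
      Matrix.one_mul, hV1]
  have hW2 : (Uᴴ * V) * (Uᴴ * V)ᴴ = 1 := by
    rw [conjTranspose_mul, conjTranspose_conjTranspose, Matrix.mul_assoc, ← Matrix.mul_assoc V, hV2,
      Matrix.one_mul, hU1]
  have tA : A.trace.re = ∑ i, a i := by
    rw [hAe, trace_mul_comm, ← Matrix.mul_assoc, hU1, Matrix.one_mul, trace_diagonal]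
    simp
  have tC : C.trace.re = ∑ i, c i := by
    rw [hCe, trace_mul_comm, ← Matrix.mul_assoc, hV1, Matrix.one_mul, trace_diagonal]
    simp
  have tAA : (A * matLog A).trace.re = ∑ i, a i * Real.log (a i) := by
    rw [hAl]
    conv_lhs => rw [hAe]
    rw [trace_conj_formula, hU1, Complex.ofReal_re]
    refine Finset.sum_congr rfl fun i _ => ?_
    rw [Finset.sum_eq_single i]
    · simp
    · intro j _ hj
      simp [one_apply_ne hj.symm]
    · simp
  have tAC : (A * matLog C).trace.re =
      ∑ i, ∑ j, Complex.normSq ((Uᴴ * V) i j) * (a i * Real.log (c j)) := by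
    rw [hCl, hAe, trace_conj_formula, Complex.ofReal_re]
  have hex : ∃ i j, (Uᴴ * V) i j ≠ 0 ∧ a i ≠ c j := by
    by_contra! hcon
    apply hne
    have hD : diagonal (fun i => (a i : ℂ)) * (Uᴴ * V) =
        (Uᴴ * V) * diagonal (fun i => (c i : ℂ)) := by
      ext i j
      rw [diagonal_mul, mul_diagonal]
      by_cases h : (Uᴴ * V) i j = 0
      · simp [h]
      · rw [hcon i j h, mul_comm]
    calc A = U * (diagonal (fun i => (a i : ℂ)) * (Uᴴ * V)) * Vᴴ := by
            conv_lhs => rw [hAe]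
            simp only [Matrix.mul_assoc, hV2, Matrix.mul_one]
      _ = (U * Uᴴ) * (V * diagonal (fun i => (c i : ℂ)) * Vᴴ) := by
            rw [hD]; simp only [Matrix.mul_assoc]
      _ = C := by rw [hU2, Matrix.one_mul, ← hCe]
  generalize Uᴴ * V = W at *
  have hr := sum_normSq_row hW2
  have hcl := sum_normSq_col hW1
  have hsum : ∑ i, ∑ j, Complex.normSq (W i j) *
      (a i * Real.log (a i) - a i * Real.log (c j) - a i + c j) =
      (∑ i, a i * Real.log (a i)) - (∑ i, ∑ j, Complex.normSq (W i j) * (a i * Real.log (c j)))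
        - (∑ i, a i) + ∑ i, c i := by
    have e1 : ∑ i, ∑ j, Complex.normSq (W i j) * (a i * Real.log (a i)) =
        ∑ i, a i * Real.log (a i) := by
      simp only [← Finset.sum_mul, hr, one_mul]
    have e2 : ∑ i, ∑ j, Complex.normSq (W i j) * a i = ∑ i, a i := by
      simp only [← Finset.sum_mul, hr, one_mul]
    have e3 : ∑ i, ∑ j, Complex.normSq (W i j) * c j = ∑ i, c i := by
      rw [Finset.sum_comm]
      simp only [← Finset.sum_mul, hcl, one_mul]
    simp only [mul_add, mul_sub, Finset.sum_add_distrib, Finset.sum_sub_distrib, e1, e2, e3]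
  have hnn : ∀ i j, 0 ≤ Complex.normSq (W i j) *
      (a i * Real.log (a i) - a i * Real.log (c j) - a i + c j) := fun i j =>
    mul_nonneg (Complex.normSq_nonneg _) (klein_scalar (ha i) (hc j))
  have hpos : 0 < ∑ i, ∑ j, Complex.normSq (W i j) *
      (a i * Real.log (a i) - a i * Real.log (c j) - a i + c j) := by
    obtain ⟨i, j, h0, hij⟩ := hex
    refine Finset.sum_pos' (fun i _ => Finset.sum_nonneg fun j _ => hnn i j)
      ⟨i, Finset.mem_univ _, Finset.sum_pos' (fun j _ => hnn i j) ⟨j, Finset.mem_univ _, ?_⟩⟩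
    exact mul_pos (Complex.normSq_pos.2 h0) (klein_scalar_lt (ha i) (hc j) hij)
  rw [tA, tC, tAA, tAC]
  linarith

/-- Strict concavity of the von Neumann entropy on positive definite complex
matrices. -/
theorem vnEntropy_strictConcave
    (A B : Matrix (Fin n) (Fin n) ℂ) (hA : A.PosDef) (hB : B.PosDef)
    (hAB : A ≠ B) (t : ℝ) (ht0 : 0 < t) (ht1 : t < 1) :
    t * vnEntropy A + (1 - t) * vnEntropy B < vnEntropy (t • A + (1 - t) • B) := by
  have hs : 0 < 1 - t := by linarith
  have hC : (t • A + (1 - t) • B).PosDef := (hA.smul ht0).add (hB.smul hs)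
  have hAC : A ≠ t • A + (1 - t) • B := by
    intro h
    have h2 : (1 - t) • (A - B) = 0 := by
      rw [smul_sub, sub_eq_zero, sub_smul, one_smul, sub_eq_iff_eq_add, add_comm]
      exact h
    exact hAB (sub_eq_zero.1 ((smul_eq_zero.1 h2).resolve_left hs.ne'))
  have hBC : B ≠ t • A + (1 - t) • B := by
    intro h
    have h2 : t • (A - B) = 0 := by
      rw [sub_smul, one_smul] at h
      rw [smul_sub]
      have h3 : t • A - t • B = (t • A + (B - t • B)) - B := by abel
      rw [h3, ← h, sub_self]
    exact hAB (sub_eq_zero.1 ((smul_eq_zero.1 h2).resolve_left ht0.ne'))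
  have k1 := mul_lt_mul_of_pos_left (klein_strict hA hC hAC) ht0
  have k2 := mul_lt_mul_of_pos_left (klein_strict hB hC hBC) hs
  have e1 : (t • A + (1 - t) • B).trace.re = t * A.trace.re + (1 - t) * B.trace.re := by
    simp [trace_add, trace_smul]
  have e2 : ∀ L : Matrix (Fin n) (Fin n) ℂ, ((t • A + (1 - t) • B) * L).trace.re =
      t * (A * L).trace.re + (1 - t) * (B * L).trace.re := by
    intro L
    simp only [Matrix.add_mul, Matrix.smul_mul, trace_add, trace_smul, Complex.add_re,
      Complex.smul_re, smul_eq_mul]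
  have e3 := e2 (matLog (t • A + (1 - t) • B))
  simp only [vnEntropy, Complex.neg_re]
  rw [e3]
  rw [e1] at k1 k2
  linarith
end

section
/- Let E be a real inner product space (for instance EuclideanSpace ℝ (Fin d)). Define η : ℝ → ℝ by η(x) = −x · ln x for x > 0 and η(x) = 0 for x ≤ 0. Then the function S(v) = η((1 + ‖v‖)/2) + η((1 − ‖v‖)/2) is concave on the closed unit ball {v : ‖v‖ ≤ 1}: for u, v in the closed unit ball and t ∈ [0, 1], S(t•u + (1−t)•v) ≥ t·S(u) + (1−t)·S(v). -/
/-- `η x = -x ln x` for `x > 0` and `η x = 0` otherwise. -/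
noncomputable def eta (x : ℝ) : ℝ :=
  if 0 < x then -x * Real.log x else 0

/-- The entropy of the spin-factor state with Bloch vector `v`:
`S v = η((1 + ‖v‖)/2) + η((1 - ‖v‖)/2)`. -/
noncomputable def spinEntropy {E : Type*} [NormedAddCommGroup E]
    [InnerProductSpace ℝ E] (v : E) : ℝ :=
  eta ((1 + ‖v‖) / 2) + eta ((1 - ‖v‖) / 2)

lemma eta_eq_negMulLog {x : ℝ} (hx : 0 ≤ x) : eta x = Real.negMulLog x := by
  unfold eta Real.negMulLog
  split_ifs with h
  · rfl
  · have : x = 0 := le_antisymm (not_lt.mp h) hx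
    simp [this]

lemma spinEntropy_eq_binEntropy {E : Type*} [NormedAddCommGroup E]
    [InnerProductSpace ℝ E] (v : E) (hv : ‖v‖ ≤ 1) :
    spinEntropy v = Real.binEntropy ((1 + ‖v‖) / 2) := by
  have h0 := norm_nonneg v
  rw [spinEntropy, eta_eq_negMulLog (by linarith), eta_eq_negMulLog (by linarith),
    Real.binEntropy_eq_negMulLog_add_negMulLog_one_sub]
  congr 2
  ring

/-- The spin-factor entropy is concave on the closed unit ball of a real inner
product space. -/
theorem spinEntropy_concave {E : Type*} [NormedAddCommGroup E]
    [InnerProductSpace ℝ E] (u v : E) (hu : ‖u‖ ≤ 1) (hv : ‖v‖ ≤ 1)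
    (t : ℝ) (ht0 : 0 ≤ t) (ht1 : t ≤ 1) :
    t * spinEntropy u + (1 - t) * spinEntropy v
      ≤ spinEntropy (t • u + (1 - t) • v) := by
  have hs : 0 ≤ 1 - t := by linarith
  have hu0 := norm_nonneg u
  have hv0 := norm_nonneg v
  have hw0 := norm_nonneg (t • u + (1 - t) • v)
  have htri : ‖t • u + (1 - t) • v‖ ≤ t * ‖u‖ + (1 - t) * ‖v‖ := by
    refine (norm_add_le _ _).trans ?_
    rw [norm_smul, norm_smul, Real.norm_of_nonneg ht0, Real.norm_of_nonneg hs]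
  have hle : t * ‖u‖ + (1 - t) * ‖v‖ ≤ 1 := by nlinarith
  rw [spinEntropy_eq_binEntropy u hu, spinEntropy_eq_binEntropy v hv,
    spinEntropy_eq_binEntropy _ (htri.trans hle)]
  have hc := Real.strictConcave_binEntropy.concaveOn.2
    (x := (1 + ‖u‖) / 2) ⟨by linarith, by linarith⟩
    (y := (1 + ‖v‖) / 2) ⟨by linarith, by linarith⟩ ht0 hs (by ring)
  simp only [smul_eq_mul] at hc
  refine hc.trans ?_
  have he : t * ((1 + ‖u‖) / 2) + (1 - t) * ((1 + ‖v‖) / 2)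
      = (1 + (t * ‖u‖ + (1 - t) * ‖v‖)) / 2 := by ring
  rw [he]
  exact Real.binEntropy_strictAntiOn.antitoneOn
    ⟨by norm_num; linarith, by linarith⟩ ⟨by norm_num; linarith, by linarith⟩ (by linarith)
end

section
/- Shannon entropy is antitone with respect to majorization: let p, q : Fin n → ℝ be probability vectors (nonnegative entries summing to 1) that are both nonincreasing (p_1 ≥ p_2 ≥ … ≥ p_n and likewise for q), and suppose p majorizes q, i.e. ∑_{i=1}^{k} p_i ≥ ∑_{i=1}^{k} q_i for every k ≤ n. Then −∑_i p_i ln p_i ≤ −∑_i q_i ln q_i, with the convention 0 · ln 0 = 0. -/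
theorem abel_aux : ∀ (n : ℕ) (c d : Fin n → ℝ) (L : ℝ), Antitone c → (∀ i, L ≤ c i) →
    (∀ k : ℕ, k ≤ n → 0 ≤ ∑ i : Fin n, if (i : ℕ) < k then d i else 0) →
    L * ∑ i, d i ≤ ∑ i, c i * d i := by
  intro n
  induction n with
  | zero => intro c d L _ _ _; simp
  | succ n ih =>
    intro c d L hc hL hd
    have h1 := ih (fun i => c i.castSucc) (fun i => d i.castSucc) (c (Fin.last n))
      (fun i j hij => hc (by simpa using hij)) (fun i => hc (Fin.le_last _)) (by
        intro k hk
        have := hd k (by omega)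
        rw [Fin.sum_univ_castSucc] at this
        simpa [not_lt.mpr hk] using this)
    have h2 : 0 ≤ ∑ i, d i := by
      have := hd (n + 1) le_rfl
      simpa only [Fin.is_lt, if_true] using this
    have h3 := mul_le_mul_of_nonneg_right (hL (Fin.last n)) h2
    refine h3.trans ?_
    rw [Fin.sum_univ_castSucc, Fin.sum_univ_castSucc, mul_add]
    linarith

theorem gibbs_aux {p q : ℝ} (hp : 0 ≤ p) (hq : 0 < q) :
    p - q + Real.log q * (p - q) ≤ p * Real.log p - q * Real.log q := by
  rcases hp.eq_or_lt with rfl | hp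
  · simp; linarith
  · have h := Real.log_le_sub_one_of_pos (div_pos hq hp)
    rw [Real.log_div hq.ne' hp.ne'] at h
    have h2 := mul_le_mul_of_nonneg_left h hp.le
    have h3 : p * (q / p - 1) = q - p := by field_simp
    nlinarith

/-- Shannon entropy is antitone with respect to majorization: if the
nonincreasing probability vector `p` majorizes the nonincreasing probability
vector `q`, then `H(p) ≤ H(q)`.  (`Real.log 0 = 0` in Mathlib, giving the
convention `0 · ln 0 = 0`.) -/
theorem entropy_antitone_majorization {n : ℕ} (p q : Fin n → ℝ)
    (hp : (∀ i, 0 ≤ p i) ∧ ∑ i, p i = 1)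
    (hq : (∀ i, 0 ≤ q i) ∧ ∑ i, q i = 1)
    (hpmono : Antitone p) (hqmono : Antitone q)
    (hmaj : ∀ k : ℕ, k ≤ n →
      ∑ i ∈ Finset.univ.filter (fun i : Fin n => (i : ℕ) < k), q i
        ≤ ∑ i ∈ Finset.univ.filter (fun i : Fin n => (i : ℕ) < k), p i) :
    -∑ i, p i * Real.log (p i) ≤ -∑ i, q i * Real.log (q i) := by
  classical
  obtain ⟨hp0, hp1⟩ := hp
  obtain ⟨hq0, hq1⟩ := hq
  have hlog : ∀ r : Fin n → ℝ, (∀ i, 0 ≤ r i) → ∑ i, r i = 1 → ∀ i, Real.log (r i) ≤ 0 := by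
    intro r h0 h1 i
    apply Real.log_nonpos (h0 i)
    rw [← h1]
    exact Finset.single_le_sum (fun j _ => h0 j) (Finset.mem_univ i)
  have hlp := hlog p hp0 hp1
  have hlq := hlog q hq0 hq1
  have hsum : ∀ f : Fin n → ℝ, (∀ i, f i ≤ 0) → ∀ i, ∑ j, f j ≤ f i := by
    intro f hf i
    have := Finset.single_le_sum (f := fun j => - f j) (fun j _ => by simpa using hf j)
      (Finset.mem_univ i)
    simp only [Finset.sum_neg_distrib] at this
    linarith
  obtain ⟨L, hLq, hLp⟩ : ∃ L : ℝ, (∀ i, L ≤ Real.log (q i)) ∧ ∀ i, L ≤ Real.log (p i) - 1 := by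
    refine ⟨∑ i, Real.log (q i) + ∑ i, Real.log (p i) - 1, fun i => ?_, fun i => ?_⟩
    · have h1 := hsum _ hlq i
      have h2 := Finset.sum_nonpos (fun i (_ : i ∈ Finset.univ) => hlp i)
      linarith
    · have h1 := hsum _ hlp i
      have h2 := Finset.sum_nonpos (fun i (_ : i ∈ Finset.univ) => hlq i)
      linarith
  let c : Fin n → ℝ := fun i => if q i = 0 then L else Real.log (q i)
  have hcL : ∀ i, L ≤ c i := by
    intro i
    by_cases h : q i = 0
    · simp [c, h]
    · simpa [c, h] using hLq i
  have hc : Antitone c := by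
    intro i j hij
    by_cases h : q j = 0
    · have : c j = L := by simp [c, h]
      rw [this]
      exact hcL i
    · have hj : 0 < q j := lt_of_le_of_ne (hq0 j) (Ne.symm h)
      have hji := hqmono hij
      have hi : q i ≠ 0 := (hj.trans_le hji).ne'
      simp only [c, h, hi, if_false]
      exact Real.log_le_log hj hji
  have key := abel_aux n c (fun i => p i - q i) L hc hcL (by
    intro k hk
    have := hmaj k hk
    rw [← Finset.sum_filter, Finset.sum_sub_distrib]
    linarith)
  have h0 : ∑ i, (p i - q i) = 0 := by rw [Finset.sum_sub_distrib, hp1, hq1, sub_self]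
  rw [h0, mul_zero] at key
  have hterm : ∑ i, ((p i - q i) + c i * (p i - q i)) ≤
      ∑ i, (p i * Real.log (p i) - q i * Real.log (q i)) := by
    apply Finset.sum_le_sum
    intro i _
    by_cases h : q i = 0
    · simp only [c, h, if_true]
      have := mul_le_mul_of_nonneg_left (hLp i) (hp0 i)
      simp only [sub_zero, zero_mul]
      linarith
    · simp only [c, h, if_false]
      exact gibbs_aux (hp0 i) (lt_of_le_of_ne (hq0 i) (Ne.symm h))
  rw [Finset.sum_add_distrib, h0, Finset.sum_sub_distrib] at hterm
  linarith
end
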